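/- arXiv:0912.0786 — 3 statements merged into one kernel-verified Lean document; each statement's English description precedes it below -/
import Mathlib

section
/- Let Ω be an M×n real matrix with nonnegative entries whose columns each sum to 1 (mixing weights ω_u(i) = Ω_{u,i}), and suppose the smallest eigenvalue of the symmetric M×M matrix Γ_n = ΩΩᵀ is at least K·n, where K > 0. Then there exist vectors a_1, …, a_M ∈ ℝⁿ such that (1/n)·∑_{i=1}^n ω_k(i)·a_l(i) = δ_{kl} for all 1 ≤ k, l ≤ M (δ the Kronecker delta), and (1/n)·∑_{l=1}^M ∑_{i=1}^n a_l(i)² ≤ M/K. -/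
open scoped BigOperators

/-- A real symmetric matrix with positive eigenvalues has a right inverse whose trace is the sum
of the reciprocals of the eigenvalues. -/
theorem Matrix.IsHermitian.exists_mul_eq_one_trace_eq {m : Type*} [Fintype m] [DecidableEq m]
    {A : Matrix m m ℝ} (hA : A.IsHermitian) (hpos : ∀ i, 0 < hA.eigenvalues i) :
    ∃ B : Matrix m m ℝ, A * B = 1 ∧ B.trace = ∑ i, (hA.eigenvalues i)⁻¹ := by
  set U : Matrix m m ℝ := (hA.eigenvectorUnitary : Matrix m m ℝ)
  have hU : star U * U = 1 := Unitary.coe_star_mul_self hA.eigenvectorUnitary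
  have hU' : U * star U = 1 := Unitary.coe_mul_star_self hA.eigenvectorUnitary
  have hAU : A = U * Matrix.diagonal hA.eigenvalues * star U := by
    simpa [Unitary.conjStarAlgAut_apply, Function.comp_def] using hA.spectral_theorem
  have hD : Matrix.diagonal hA.eigenvalues *
      Matrix.diagonal (fun i => (hA.eigenvalues i)⁻¹) = 1 := by
    rw [Matrix.diagonal_mul_diagonal, ← Matrix.diagonal_one]
    congr 1
    funext i
    exact mul_inv_cancel₀ (hpos i).ne'
  refine ⟨U * Matrix.diagonal (fun i => (hA.eigenvalues i)⁻¹) * star U, ?_, ?_⟩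
  · calc A * (U * Matrix.diagonal (fun i => (hA.eigenvalues i)⁻¹) * star U)
        = U * Matrix.diagonal hA.eigenvalues * (star U * U) *
            Matrix.diagonal (fun i => (hA.eigenvalues i)⁻¹) * star U := by
          refine (congrArg (· * (U * Matrix.diagonal (fun i => (hA.eigenvalues i)⁻¹) * star U))
            hAU).trans ?_
          simp only [Matrix.mul_assoc]
      _ = U * (Matrix.diagonal hA.eigenvalues *
            Matrix.diagonal (fun i => (hA.eigenvalues i)⁻¹)) * star U := by
          rw [hU, Matrix.mul_one, Matrix.mul_assoc U]
      _ = 1 := by rw [hD, Matrix.mul_one, hU']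
  · rw [Matrix.trace_mul_comm, ← Matrix.mul_assoc, hU, Matrix.one_mul, Matrix.trace_diagonal]

/-- If `Ω` is an `M × n` matrix of mixing weights (nonnegative entries,
columns summing to `1`) and the smallest eigenvalue of `Γ_n = Ω * Ωᵀ` is at least `K * n`
with `K > 0`, then there exist vectors `a_1, …, a_M ∈ ℝⁿ` biorthogonal to the rows of `Ω`
(w.r.t. the inner product `⟨u,v⟩_n = (1/n) ∑ u i * v i`) with
`(1/n) ∑_l ∑_i a_l(i)² ≤ M / K`. -/
theorem stmt0 (M n : ℕ) (hM : 0 < M) (hn : 0 < n) (hMn : M ≤ n)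
    (K : ℝ) (hK : 0 < K)
    (W : Matrix (Fin M) (Fin n) ℝ)
    (hW0 : ∀ u i, 0 ≤ W u i)
    (hWcol : ∀ i, ∑ u, W u i = 1)
    (hherm : (W * W.transpose).IsHermitian)
    (heig : ∀ u, K * n ≤ hherm.eigenvalues u) :
    ∃ a : Fin M → Fin n → ℝ,
      (∀ k l, (1 / (n : ℝ)) * ∑ i, W k i * a l i = if k = l then 1 else 0) ∧
      (1 / (n : ℝ)) * ∑ l, ∑ i, (a l i) ^ 2 ≤ M / K := by
  have hn' : (0 : ℝ) < n := Nat.cast_pos.mpr hn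
  have hpos : ∀ u, 0 < hherm.eigenvalues u := fun u => (mul_pos hK hn').trans_le (heig u)
  obtain ⟨B, hB, htr⟩ := hherm.exists_mul_eq_one_trace_eq hpos
  have hBT : B.transpose * (W * W.transpose) = 1 := by
    simpa [Matrix.transpose_mul] using congrArg Matrix.transpose hB
  have hle : B.trace ≤ M / (K * n) := by
    rw [htr]
    calc ∑ u, (hherm.eigenvalues u)⁻¹ ≤ ∑ _u : Fin M, (K * n)⁻¹ :=
          Finset.sum_le_sum fun u _ => inv_anti₀ (mul_pos hK hn') (heig u)
      _ = M / (K * n) := by simp [div_eq_mul_inv]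
  refine ⟨fun l i => n * (W.transpose * B) i l, fun k l => ?_, ?_⟩
  · calc (1 / (n : ℝ)) * ∑ i, W k i * (n * (W.transpose * B) i l)
        = ∑ i, W k i * (W.transpose * B) i l := by
          rw [Finset.mul_sum]
          refine Finset.sum_congr rfl fun i _ => ?_
          field_simp
      _ = (W * W.transpose * B) k l := by rw [Matrix.mul_assoc, Matrix.mul_apply]
      _ = if k = l then 1 else 0 := by rw [hB, Matrix.one_apply]
  · have hsum : ∑ l, ∑ i, ((W.transpose * B) i l) ^ 2 = B.trace := by
      calc ∑ l, ∑ i, ((W.transpose * B) i l) ^ 2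
          = ((W.transpose * B).transpose * (W.transpose * B)).trace := by
            simp only [Matrix.trace, Matrix.diag_apply, Matrix.mul_apply (M := Matrix.transpose _),
              Matrix.transpose_apply, sq]
        _ = (B.transpose * (W * W.transpose) * B).trace := by
            simp only [Matrix.transpose_mul, Matrix.transpose_transpose, Matrix.mul_assoc]
        _ = B.trace := by rw [hBT, Matrix.one_mul]
    calc (1 / (n : ℝ)) * ∑ l, ∑ i, (n * (W.transpose * B) i l) ^ 2
        = n * B.trace := by
          simp only [mul_pow, ← Finset.mul_sum]
          rw [hsum]
          field_simp
      _ ≤ n * (M / (K * n)) := mul_le_mul_of_nonneg_left hle hn'.le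
      _ = M / K := by field_simp
end

section
/- Let p and q be probability densities on ℝ belonging to L²(ℝ). Then for every j ∈ ℕ, ∑_{k∈ℤ} ( ∫_ℝ φ_{jk}·p − ∫_ℝ φ_{jk}·q )² ≤ 2L·‖p − q‖₂². -/
open MeasureTheory

/-- Cauchy–Schwarz against a function of unit `L²` norm. -/
theorem sq_integral_mul_le {α : Type*} [MeasurableSpace α] {μ : Measure α} {f h : α → ℝ}
    (hf : Integrable (fun x => f x ^ 2) μ) (hh : Integrable (fun x => h x ^ 2) μ)
    (hfh : Integrable (fun x => f x * h x) μ) (hf1 : ∫ x, f x ^ 2 ∂μ = 1) :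
    (∫ x, f x * h x ∂μ) ^ 2 ≤ ∫ x, h x ^ 2 ∂μ := by
  set a := ∫ x, f x * h x ∂μ with ha
  have h0 : 0 ≤ ∫ x, (a * f x - h x) ^ 2 ∂μ := integral_nonneg fun x => sq_nonneg _
  have h1 : ∫ x, (a * f x - h x) ^ 2 ∂μ = a ^ 2 * 1 - 2 * a * a + ∫ x, h x ^ 2 ∂μ := by
    calc ∫ x, (a * f x - h x) ^ 2 ∂μ
        = ∫ x, (a ^ 2 * f x ^ 2 - 2 * a * (f x * h x) + h x ^ 2) ∂μ :=
          integral_congr_ae (.of_forall fun x => by ring)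
      _ = a ^ 2 * 1 - 2 * a * a + ∫ x, h x ^ 2 ∂μ := by
          have hsub : Integrable (fun x => a ^ 2 * f x ^ 2 - 2 * a * (f x * h x)) μ :=
            (hf.const_mul _).sub (hfh.const_mul _)
          rw [integral_add hsub hh,
            integral_sub (hf.const_mul _) (hfh.const_mul _), integral_const_mul,
            integral_const_mul, hf1, ← ha]
  nlinarith

/-- A half-open interval of length `2 * L` contains at most `2 * L` points of any finite set
of integers. -/
theorem card_filter_sub_mem_Ico_le (L : ℕ) (y : ℝ) (s : Finset ℤ) [DecidablePred
    fun k : ℤ => y - k ∈ Set.Ico (-(L : ℝ)) (L : ℝ)] :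
    (s.filter fun k : ℤ => y - k ∈ Set.Ico (-(L : ℝ)) (L : ℝ)).card ≤ 2 * L := by
  have hsub : (s.filter fun k : ℤ => y - k ∈ Set.Ico (-(L : ℝ)) (L : ℝ)) ⊆
      Finset.Ioc (⌊y⌋ - L) (⌊y⌋ + L) := by
    intro k hk
    obtain ⟨-, h1, h2⟩ := Finset.mem_filter.1 hk
    rw [Finset.mem_Ioc]
    constructor
    · have : ⌊y⌋ < k + L := Int.floor_lt.2 (by push_cast; linarith)
      omega
    · have : k - L ≤ ⌊y⌋ := Int.le_floor.2 (by push_cast; linarith)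
      omega
  refine (Finset.card_le_card hsub).trans ?_
  rw [Int.card_Ioc]
  omega

/-- For probability densities `p, q ∈ L²(ℝ)` and every `j ∈ ℕ`,
`∑_{k ∈ ℤ} (∫ φ_{jk} p - ∫ φ_{jk} q)² ≤ 2 L ‖p - q‖₂²`, where
`φ_{jk}(x) = 2^{j/2} φ(2^j x - k)`, `φ` being bounded measurable, supported in `[-L, L)`,
with `‖φ‖₂ = 1`. -/
theorem stmt7 (L : ℕ) (hL : 0 < L)
    (φ : ℝ → ℝ) (hφm : Measurable φ) (hφb : ∃ B : ℝ, ∀ x, |φ x| ≤ B)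
    (hφsupp : ∀ x, φ x ≠ 0 → x ∈ Set.Ico (-(L : ℝ)) (L : ℝ))
    (hφ2 : ∫ x, (φ x) ^ 2 = 1)
    (p q : ℝ → ℝ)
    (hpm : Measurable p) (hp0 : ∀ x, 0 ≤ p x) (hp1 : ∫ x, p x = 1)
    (hqm : Measurable q) (hq0 : ∀ x, 0 ≤ q x) (hq1 : ∫ x, q x = 1)
    (hpi : Integrable p) (hqi : Integrable q)
    (hp2 : Integrable fun x => (p x) ^ 2) (hq2 : Integrable fun x => (q x) ^ 2)
    (j : ℕ) :
    ∑' k : ℤ,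
        ((∫ x, (2 : ℝ) ^ ((j : ℝ) / 2) * φ (2 ^ j * x - k) * p x) -
          ∫ x, (2 : ℝ) ^ ((j : ℝ) / 2) * φ (2 ^ j * x - k) * q x) ^ 2 ≤
      2 * L * ∫ x, (p x - q x) ^ 2 := by
  obtain ⟨B, hB⟩ := hφb
  have hφi : Integrable fun x => φ x ^ 2 := .of_integral_ne_zero (by rw [hφ2]; exact one_ne_zero)
  have h2j : (0 : ℝ) < 2 ^ j := by positivity
  have hc : ((2 : ℝ) ^ ((j : ℝ) / 2)) ^ 2 = 2 ^ j := by
    rw [← Real.rpow_natCast, ← Real.rpow_mul (by norm_num), ← Real.rpow_natCast]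
    congr 1
    push_cast
    ring
  set c : ℝ := (2 : ℝ) ^ ((j : ℝ) / 2)
  set g : ℝ → ℝ := fun x => p x - q x with hg
  have hgm : Measurable g := hpm.sub hqm
  have hg2 : Integrable fun x => g x ^ 2 :=
    (((memLp_two_iff_integrable_sq hpm.aestronglyMeasurable).2 hp2).sub
      ((memLp_two_iff_integrable_sq hqm.aestronglyMeasurable).2 hq2)).integrable_sq
  have hψm (k : ℤ) : Measurable fun x : ℝ => c * φ (2 ^ j * x - k) := by fun_prop
  have hψmul (k : ℤ) {f : ℝ → ℝ} (hf : Integrable f) :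
      Integrable fun x => c * φ (2 ^ j * x - k) * f x := by
    refine hf.bdd_mul (c := |c| * B) (hψm k).aestronglyMeasurable (.of_forall fun x => ?_)
    rw [Real.norm_eq_abs, abs_mul]
    exact mul_le_mul_of_nonneg_left (hB _) (abs_nonneg _)
  have hψi (k : ℤ) : Integrable fun x : ℝ => (c * φ (2 ^ j * x - k)) ^ 2 := by
    simp_rw [mul_pow]
    exact ((hφi.comp_sub_right (k : ℝ)).comp_mul_left' h2j.ne').const_mul _
  have hψ1 (k : ℤ) : ∫ x : ℝ, (c * φ (2 ^ j * x - k)) ^ 2 = 1 := by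
    simp_rw [mul_pow]
    rw [integral_const_mul, Measure.integral_comp_mul_left (fun x => φ (x - k) ^ 2),
      integral_sub_right_eq_self (fun x => φ x ^ 2), hφ2, hc, abs_of_pos (inv_pos.2 h2j)]
    simp
  let S (k : ℤ) : Set ℝ := {x | 2 ^ j * x - k ∈ Set.Ico (-(L : ℝ)) (L : ℝ)}
  have hS (k : ℤ) : MeasurableSet (S k) :=
    measurableSet_Ico.preimage (by fun_prop : Measurable fun x : ℝ => 2 ^ j * x - k)
  have hSi (k : ℤ) : Integrable ((S k).indicator fun x => g x ^ 2) := hg2.indicator (hS k)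
  have hterm (k : ℤ) : ((∫ x, c * φ (2 ^ j * x - k) * p x) -
      ∫ x, c * φ (2 ^ j * x - k) * q x) ^ 2 ≤ ∫ x, (S k).indicator (fun x => g x ^ 2) x := by
    have hsq : (fun x => ((S k).indicator g x) ^ 2) = (S k).indicator fun x => g x ^ 2 := by
      ext x
      by_cases hx : x ∈ S k <;> simp [hx]
    have hmul : (fun x => c * φ (2 ^ j * x - k) * (S k).indicator g x) =
        fun x => c * φ (2 ^ j * x - k) * p x - c * φ (2 ^ j * x - k) * q x := by
      ext x
      by_cases hx : x ∈ S k
      · simp [hx, hg, mul_sub]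
      · have : φ (2 ^ j * x - k) = 0 := by
          by_contra h
          exact hx (hφsupp _ h)
        simp [this]
    rw [← integral_sub (hψmul k hpi) (hψmul k hqi), ← hmul, ← hsq]
    refine sq_integral_mul_le (hψi k) (hsq ▸ hSi k) ?_ (hψ1 k)
    rw [hmul]
    exact (hψmul k hpi).sub (hψmul k hqi)
  refine Real.tsum_le_of_sum_le (fun k => sq_nonneg _) fun s => ?_
  refine (Finset.sum_le_sum fun k _ => hterm k).trans ?_
  rw [← integral_finsetSum _ fun k _ => hSi k, ← integral_const_mul]
  refine integral_mono (integrable_finsetSum _ fun k _ => hSi k) (hg2.const_mul _) fun x => ?_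
  classical
  have hcard := card_filter_sub_mem_Ico_le L (2 ^ j * x) s
  calc ∑ k ∈ s, (S k).indicator (fun x => g x ^ 2) x
      = (s.filter fun k : ℤ => 2 ^ j * x - k ∈ Set.Ico (-(L : ℝ)) (L : ℝ)).card * g x ^ 2 := by
        rw [← nsmul_eq_mul, ← Finset.sum_const, Finset.sum_filter]
        exact Finset.sum_congr rfl fun k _ => Set.indicator_apply _ _ _
    _ ≤ 2 * L * g x ^ 2 := by
        gcongr
        exact_mod_cast hcard
end

section
/- Let p_l, q_l, p_{l'}, q_{l'} be probability densities on ℝ belonging to L²(ℝ). Then for every j ∈ ℕ, ∑_{k∈ℤ} ∑_{k' : I_{jk} ∩ I_{jk'} ≠ ∅} | ( ∫ φ_{jk} p_l − ∫ φ_{jk} q_l )·( ∫ φ_{jk'} p_{l'} − ∫ φ_{jk'} q_{l'} ) | ≤ 4L²·( ‖p_l − q_l‖₂² + ‖p_{l'} − q_{l'}‖₂² ). -/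
open MeasureTheory
open scoped Classical

/-- Bessel-type bound against a unit vector supported in `s`. -/
theorem sq_integral_mul_le_setIntegral_sq {α : Type*} [MeasurableSpace α] {μ : Measure α}
    {f g : α → ℝ} {s : Set α} (hs : MeasurableSet s) (hg : ∀ x, g x ≠ 0 → x ∈ s)
    (hg2 : ∫ x, g x ^ 2 ∂μ = 1) (hf2 : Integrable (fun x => f x ^ 2) μ)
    (hgf : Integrable (fun x => g x * f x) μ) :
    (∫ x, g x * f x ∂μ) ^ 2 ≤ ∫ x in s, f x ^ 2 ∂μ := by
  set c := ∫ x, g x * f x ∂μ with hc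
  have hgi : Integrable (fun x => g x ^ 2) μ := .of_integral_ne_zero (by simp [hg2])
  have h0 : 0 ≤ ∫ x, (s.indicator (fun x => f x ^ 2) x - 2 * c * (g x * f x))
      + c ^ 2 * g x ^ 2 ∂μ := by
    refine integral_nonneg fun x => ?_
    by_cases hx : x ∈ s
    · simp only [Set.indicator_of_mem hx, Pi.zero_apply]
      nlinarith [sq_nonneg (f x - c * g x)]
    · have : g x = 0 := by
        by_contra h
        exact hx (hg x h)
      simp [Set.indicator_of_notMem hx, this]
  have hfi := hf2.indicator hs
  have hgf' := hgf.const_mul (2 * c)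
  rw [integral_add (by exact hfi.sub hgf') (hgi.const_mul _),
    integral_sub hfi hgf', integral_const_mul, integral_const_mul,
    integral_indicator hs, hg2, ← hc] at h0
  linarith

/-- The intervals `[(k - L) / c, (k + L) / c)` cover each point at most `2 * L` times. -/
theorem sum_indicator_Ico_le (L : ℕ) {c : ℝ} (hc : 0 < c) (s : Finset ℤ) {y : ℝ} (hy : 0 ≤ y)
    (x : ℝ) :
    ∑ k ∈ s, (Set.Ico (((k : ℝ) - L) / c) (((k : ℝ) + L) / c)).indicator (fun _ => y) x
      ≤ 2 * L * y := by
  simp only [Set.indicator_apply]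
  rw [← Finset.sum_filter, Finset.sum_const, nsmul_eq_mul]
  refine mul_le_mul_of_nonneg_right ?_ hy
  have hsub : s.filter (fun k : ℤ => x ∈ Set.Ico (((k : ℝ) - L) / c) (((k : ℝ) + L) / c)) ⊆
      Finset.Ioc (⌊x * c⌋ - L) (⌊x * c⌋ + L) := by
    intro k hk
    obtain ⟨-, h1, h2⟩ := Finset.mem_filter.1 hk
    rw [div_le_iff₀ hc] at h1
    rw [lt_div_iff₀ hc] at h2
    rw [Finset.mem_Ioc]
    constructor
    · have : ⌊x * c⌋ < k + L := by
        rw [Int.floor_lt]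
        push_cast
        exact h2
      omega
    · have : k - L ≤ ⌊x * c⌋ := by
        rw [Int.le_floor]
        push_cast
        exact h1
      omega
  have hcard := Finset.card_le_card hsub
  rw [Int.card_Ioc] at hcard
  have : (s.filter (fun k : ℤ =>
      x ∈ Set.Ico (((k : ℝ) - L) / c) (((k : ℝ) + L) / c))).card ≤ 2 * L := by omega
  exact_mod_cast this

theorem sum_setIntegral_Ico_sq_le (L : ℕ) {c : ℝ} (hc : 0 < c) (s : Finset ℤ) {f : ℝ → ℝ}
    (hf2 : Integrable fun x => f x ^ 2) :
    ∑ k ∈ s, ∫ x in Set.Ico (((k : ℝ) - L) / c) (((k : ℝ) + L) / c), f x ^ 2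
      ≤ 2 * L * ∫ x, f x ^ 2 := by
  simp_rw [← integral_indicator (measurableSet_Ico (α := ℝ))]
  rw [← integral_finsetSum _ fun k _ => hf2.indicator measurableSet_Ico, ← integral_const_mul]
  refine integral_mono (integrable_finsetSum _ fun k _ => hf2.indicator measurableSet_Ico)
    (hf2.const_mul _) fun x => ?_
  exact sum_indicator_Ico_le L hc s (sq_nonneg (f x)) x

theorem integral_sq_dilation {φ : ℝ → ℝ} (hφ2 : ∫ x, φ x ^ 2 = 1) (j : ℕ) (k : ℤ) :
    ∫ x, ((2 : ℝ) ^ ((j : ℝ) / 2) * φ (2 ^ j * x - k)) ^ 2 = 1 := by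
  have h2 : ((2 : ℝ) ^ ((j : ℝ) / 2)) ^ 2 = 2 ^ j := by
    rw [← Real.rpow_natCast, ← Real.rpow_mul (by norm_num), ← Real.rpow_natCast]
    congr 1
    push_cast
    ring
  simp_rw [mul_pow, h2]
  rw [integral_const_mul, Measure.integral_comp_mul_left (fun y => φ (y - k) ^ 2),
    integral_sub_right_eq_self (fun y => φ y ^ 2), hφ2, abs_of_nonneg (by positivity)]
  simp

theorem integrable_dilation_mul {φ : ℝ → ℝ} (hφm : Measurable φ) (hφb : ∃ B : ℝ, ∀ x, |φ x| ≤ B)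
    {f : ℝ → ℝ} (hf : Integrable f) (j : ℕ) (k : ℤ) :
    Integrable fun x => (2 : ℝ) ^ ((j : ℝ) / 2) * φ (2 ^ j * x - k) * f x := by
  obtain ⟨B, hB⟩ := hφb
  simp_rw [mul_assoc]
  refine Integrable.const_mul ?_ _
  refine hf.bdd_mul (c := B) ?_ (.of_forall fun x => hB _)
  exact (hφm.comp (by fun_prop)).aestronglyMeasurable

theorem sum_sq_integral_dilation_sub_le (L : ℕ) {φ : ℝ → ℝ} (hφm : Measurable φ)
    (hφb : ∃ B : ℝ, ∀ x, |φ x| ≤ B)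
    (hφsupp : ∀ x, φ x ≠ 0 → x ∈ Set.Ico (-(L : ℝ)) (L : ℝ)) (hφ2 : ∫ x, φ x ^ 2 = 1)
    {p q : ℝ → ℝ} (hp : Integrable p) (hq : Integrable q)
    (hpq : Integrable fun x => (p x - q x) ^ 2) (j : ℕ) (s : Finset ℤ) :
    ∑ k ∈ s, ((∫ x, (2 : ℝ) ^ ((j : ℝ) / 2) * φ (2 ^ j * x - k) * p x) -
        ∫ x, (2 : ℝ) ^ ((j : ℝ) / 2) * φ (2 ^ j * x - k) * q x) ^ 2
      ≤ 2 * L * ∫ x, (p x - q x) ^ 2 := by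
  have hc : (0 : ℝ) < 2 ^ j := by positivity
  refine le_trans (Finset.sum_le_sum fun k _ => ?_) (sum_setIntegral_Ico_sq_le L hc s hpq)
  rw [← integral_sub (integrable_dilation_mul hφm hφb hp j k)
    (integrable_dilation_mul hφm hφb hq j k)]
  simp_rw [← mul_sub]
  refine sq_integral_mul_le_setIntegral_sq measurableSet_Ico (fun x hx => ?_)
    (integral_sq_dilation hφ2 j k) hpq (integrable_dilation_mul hφm hφb (hp.sub hq) j k)
  obtain ⟨h1, h2⟩ := hφsupp _ (right_ne_zero_of_mul hx)
  rw [Set.mem_Ico, div_le_iff₀ hc, lt_div_iff₀ hc]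
  constructor <;> linarith

theorem tsum_tsum_band_abs_mul_le (L : ℕ) (P : ℤ → ℤ → Prop)
    (hP : ∀ k k', P k k' → |k' - k| < 2 * L) (a b : ℤ → ℝ) {A B : ℝ}
    (hA : ∀ s : Finset ℤ, ∑ k ∈ s, a k ^ 2 ≤ A) (hB : ∀ s : Finset ℤ, ∑ k ∈ s, b k ^ 2 ≤ B) :
    ∑' k, ∑' k', (if P k k' then |a k * b k'| else 0) ≤ 2 * L * (A + B) := by
  have hA0 : 0 ≤ A := by simpa using hA ∅
  have hB0 : 0 ≤ B := by simpa using hB ∅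
  refine tsum_le_of_sum_le' (by positivity) fun s => ?_
  set D := Finset.Ioo (-(2 * L : ℤ)) (2 * L)
  have hD : (D.card : ℝ) ≤ 4 * L := by
    have : D.card ≤ 4 * L := by
      rw [Int.card_Ioo]
      omega
    exact_mod_cast this
  have hinner : ∀ k, ∑' k', (if P k k' then |a k * b k'| else 0) ≤
      ∑ d ∈ D, (a k ^ 2 + b (k + d) ^ 2) / 2 := by
    intro k
    rw [← (Equiv.addLeft k).tsum_eq, tsum_eq_sum (s := D)]
    · refine Finset.sum_le_sum fun d _ => ?_
      change (if P k (k + d) then |a k * b (k + d)| else 0) ≤ _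
      by_cases h : P k (k + d)
      · rw [if_pos h, abs_mul]
        nlinarith [sq_nonneg (|a k| - |b (k + d)|), sq_abs (a k), sq_abs (b (k + d))]
      · rw [if_neg h]
        positivity
    · intro d hd
      rw [if_neg]
      intro h
      have := hP _ _ h
      simp only [Equiv.coe_addLeft, add_sub_cancel_left, abs_lt] at this
      exact hd (Finset.mem_Ioo.2 this)
  calc ∑ k ∈ s, ∑' k', (if P k k' then |a k * b k'| else 0)
      ≤ ∑ k ∈ s, ∑ d ∈ D, (a k ^ 2 + b (k + d) ^ 2) / 2 := Finset.sum_le_sum fun k _ => hinner k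
    _ = ∑ d ∈ D, (∑ k ∈ s, a k ^ 2 + ∑ k ∈ s, b (k + d) ^ 2) / 2 := by
        rw [Finset.sum_comm]
        simp_rw [← Finset.sum_div, Finset.sum_add_distrib]
    _ ≤ ∑ _d ∈ D, (A + B) / 2 := by
        refine Finset.sum_le_sum fun d _ => ?_
        have hb : ∑ k ∈ s, b (k + d) ^ 2 ≤ B := by
          simpa using hB (s.map (Equiv.addRight d).toEmbedding)
        linarith [hA s]
    _ = D.card * ((A + B) / 2) := by rw [Finset.sum_const, nsmul_eq_mul]
    _ ≤ 4 * L * ((A + B) / 2) := by gcongr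
    _ = 2 * L * (A + B) := by ring

/-- For probability densities `p_l, q_l, p_{l'}, q_{l'} ∈ L²(ℝ)` and every
`j ∈ ℕ`,
`∑_k ∑_{k' : I_{jk} ∩ I_{jk'} ≠ ∅} |(∫ φ_{jk} p_l - ∫ φ_{jk} q_l)(∫ φ_{jk'} p_{l'} - ∫ φ_{jk'} q_{l'})|
  ≤ 4 L² (‖p_l - q_l‖₂² + ‖p_{l'} - q_{l'}‖₂²)`,
where `I_{jk} = [(k-L)/2^j, (k+L)/2^j)` and `φ_{jk}(x) = 2^{j/2} φ(2^j x - k)`. -/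
theorem stmt8 (L : ℕ) (hL : 0 < L)
    (φ : ℝ → ℝ) (hφm : Measurable φ) (hφb : ∃ B : ℝ, ∀ x, |φ x| ≤ B)
    (hφsupp : ∀ x, φ x ≠ 0 → x ∈ Set.Ico (-(L : ℝ)) (L : ℝ))
    (hφ2 : ∫ x, (φ x) ^ 2 = 1)
    (pl ql pl' ql' : ℝ → ℝ)
    (hplm : Measurable pl) (hpl0 : ∀ x, 0 ≤ pl x) (hpl1 : ∫ x, pl x = 1)
    (hqlm : Measurable ql) (hql0 : ∀ x, 0 ≤ ql x) (hql1 : ∫ x, ql x = 1)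
    (hplm' : Measurable pl') (hpl0' : ∀ x, 0 ≤ pl' x) (hpl1' : ∫ x, pl' x = 1)
    (hqlm' : Measurable ql') (hql0' : ∀ x, 0 ≤ ql' x) (hql1' : ∫ x, ql' x = 1)
    (hpl2 : Integrable fun x => (pl x) ^ 2) (hql2 : Integrable fun x => (ql x) ^ 2)
    (hpl2' : Integrable fun x => (pl' x) ^ 2) (hql2' : Integrable fun x => (ql' x) ^ 2)
    (j : ℕ) :
    ∑' k : ℤ, ∑' k' : ℤ,
        (if (Set.Ico (((k : ℝ) - L) / 2 ^ j) (((k : ℝ) + L) / 2 ^ j) ∩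
              Set.Ico (((k' : ℝ) - L) / 2 ^ j) (((k' : ℝ) + L) / 2 ^ j)).Nonempty then
          |((∫ x, (2 : ℝ) ^ ((j : ℝ) / 2) * φ (2 ^ j * x - k) * pl x) -
              ∫ x, (2 : ℝ) ^ ((j : ℝ) / 2) * φ (2 ^ j * x - k) * ql x) *
            ((∫ x, (2 : ℝ) ^ ((j : ℝ) / 2) * φ (2 ^ j * x - k') * pl' x) -
              ∫ x, (2 : ℝ) ^ ((j : ℝ) / 2) * φ (2 ^ j * x - k') * ql' x)|
        else 0) ≤
      4 * L ^ 2 * ((∫ x, (pl x - ql x) ^ 2) + ∫ x, (pl' x - ql' x) ^ 2) := by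
  have sq_sub : ∀ {p q : ℝ → ℝ}, Measurable p → Measurable q → Integrable (fun x => p x ^ 2) →
      Integrable (fun x => q x ^ 2) → Integrable fun x => (p x - q x) ^ 2 := by
    intro p q hp hq hp2 hq2
    exact (((memLp_two_iff_integrable_sq hp.aestronglyMeasurable).2 hp2).sub
      ((memLp_two_iff_integrable_sq hq.aestronglyMeasurable).2 hq2)).integrable_sq
  have integrable_of_one : ∀ {p : ℝ → ℝ}, ∫ x, p x = 1 → Integrable p := fun h =>
    .of_integral_ne_zero (by simp [h])
  refine (tsum_tsum_band_abs_mul_le L _ ?_ _ _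
    (sum_sq_integral_dilation_sub_le L hφm hφb hφsupp hφ2 (integrable_of_one hpl1)
      (integrable_of_one hql1) (sq_sub hplm hqlm hpl2 hql2) j)
    (sum_sq_integral_dilation_sub_le L hφm hφb hφsupp hφ2 (integrable_of_one hpl1')
      (integrable_of_one hql1') (sq_sub hplm' hqlm' hpl2' hql2') j)).trans
    (le_of_eq (by ring))
  rintro k k' ⟨x, ⟨h1, h2⟩, h3, h4⟩
  have hc : (0 : ℝ) < 2 ^ j := by positivity
  have h5 := (div_lt_div_iff_of_pos_right hc).1 (h1.trans_lt h4)
  have h6 := (div_lt_div_iff_of_pos_right hc).1 (h3.trans_lt h2)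
  have h7 : k - L < k' + L := by exact_mod_cast h5
  have h8 : k' - L < k + L := by exact_mod_cast h6
  rw [abs_lt]
  constructor <;> linarith
end
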